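/- Let ∃X.F(X,Y) be an ∃CNF formula and q an assignment to Vars(F). Let p be a Z-boundary point of F with q ⊆ p and Z ⊆ X. If p is removable in ∃X.F, then p is also removable in ∃X.(F|_q). -/

import Mathlib

namespace QE

noncomputable section

attribute [local instance] Classical.propDecidable

/-- A literal: a variable together with a polarity. -/
structure Lit (V : Type) where
  var : V
  pos : Bool
deriving DecidableEq

variable {V : Type} [DecidableEq V]

/-- A clause is a (finite) disjunction of literals. -/
abbrev Clause (V : Type) := Finset (Lit V)

/-- A CNF formula is a (finite) set of clauses. -/
abbrev Cnf (V : Type) := Finset (Clause V)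

/-- The variables of a clause. -/
def Clause.vars (C : Clause V) : Finset V := C.image Lit.var

/-- The variables of a CNF formula. -/
def Cnf.vars (F : Cnf V) : Finset V := F.sup Clause.vars

/-- A total assignment (point) `t` satisfies the clause `C`. -/
def Clause.satAt (t : V → Bool) (C : Clause V) : Prop := ∃ l ∈ C, t l.var = l.pos

/-- A total assignment (point) `t` falsifies the clause `C`. -/
def Clause.falsAt (t : V → Bool) (C : Clause V) : Prop := ∀ l ∈ C, t l.var = !l.pos

/-- A total assignment (point) `t` satisfies the CNF formula `F`. -/
def Cnf.satAt (t : V → Bool) (F : Cnf V) : Prop := ∀ C ∈ F, Clause.satAt t C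

/-- A partial assignment: it assigns Boolean values to some of the variables. -/
abbrev PAssign (V : Type) := V → Option Bool

/-- The set of variables assigned in `q`. -/
def PAssign.dom (q : PAssign V) : Set V := {v | q v ≠ none}

/-- `q ⊆ r` for partial assignments (viewed as sets of value assignments). -/
def PAssign.le (q r : PAssign V) : Prop := ∀ v b, q v = some b → r v = some b

/-- `q ⊊ r` for partial assignments. -/
def PAssign.lt (q r : PAssign V) : Prop := PAssign.le q r ∧ q ≠ r

/-- The point (total assignment) `t` extends the partial assignment `q`. -/
def ExtendsPnt (t : V → Bool) (q : PAssign V) : Prop := ∀ v b, q v = some b → t v = b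

/-- Two partial assignments are compatible if every commonly assigned
variable gets the same value in both. -/
def PAssign.compatible (q r : PAssign V) : Prop :=
  ∀ v b b', q v = some b → r v = some b' → b = b'

/-- The union of two partial assignments. -/
def PAssign.union (q r : PAssign V) : PAssign V := fun v => (q v).orElse fun _ => r v

/-- The clause `C` is satisfied by the partial assignment `q`. -/
def Clause.satBy (q : PAssign V) (C : Clause V) : Prop := ∃ l ∈ C, q l.var = some l.pos

/-- The cofactor `C|_q` of an (unsatisfied) clause: remove the literals falsified by `q`. -/
def Clause.restrict (q : PAssign V) (C : Clause V) : Clause V :=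
  C.filter fun l => q l.var ≠ some (!l.pos)

/-- The cofactor `F|_q` of a CNF formula: drop the clauses satisfied by `q`
(they became `true`) and remove the falsified literals from the remaining clauses. -/
def Cnf.restrict (q : PAssign V) (F : Cnf V) : Cnf V :=
  (F.filter fun C => ¬ Clause.satBy q C).image (Clause.restrict q)

/-- The formula `∃X.F` evaluates to true at the point `t`. -/
def ExSat (X : Finset V) (F : Cnf V) (t : V → Bool) : Prop :=
  ∃ t' : V → Bool, (∀ v, v ∉ X → t' v = t v) ∧ Cnf.satAt t' F

/-- Equivalence `∃X.F ≡ ∃X.G`. -/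
def Eqv (X : Finset V) (F G : Cnf V) : Prop := ∀ t : V → Bool, ExSat X F t ↔ ExSat X G t

/-- The set `G` of clauses of `F` is redundant in `∃X.F`, i.e. `∃X.F ≡ ∃X.(F \ G)`. -/
def RedundantSet (X : Finset V) (F G : Cnf V) : Prop := Eqv X F (F \ G)

/-- The CNF formula `F` implies the clause `C`. -/
def CnfImplies (F : Cnf V) (C : Clause V) : Prop :=
  ∀ t : V → Bool, Cnf.satAt t F → Clause.satAt t C

/-- The CNF formula `F` implies the CNF formula `R`. -/
def CnfImpliesCnf (F R : Cnf V) : Prop :=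
  ∀ t : V → Bool, Cnf.satAt t F → Cnf.satAt t R

/-- `C` is a `Z`-clause, i.e. `Vars(C) ∩ Z ≠ ∅`. -/
def XClause (Z : Finset V) (C : Clause V) : Prop := (Clause.vars C ∩ Z).Nonempty

/-- The point `p` is a `Z`-boundary point of `F`. -/
def BoundaryPnt (F : Cnf V) (Z : Finset V) (p : V → Bool) : Prop :=
  Z.Nonempty ∧ Z ⊆ Cnf.vars F ∧ ¬ Cnf.satAt p F ∧
  (∀ C ∈ F, Clause.falsAt p C → XClause Z C) ∧
  ∀ Z' ⊂ Z, ¬ ∀ C ∈ F, Clause.falsAt p C → XClause Z' C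

/-- The point `p` is `X'`-removable in `F`: there is a clause `C` implied by `F`,
with no variable in `X'`, falsified by `p`. -/
def Removable (F : Cnf V) (X' : Finset V) (p : V → Bool) : Prop :=
  ∃ C : Clause V, CnfImplies F C ∧ Clause.vars C ∩ X' = ∅ ∧ Clause.falsAt p C

/-- `q*`: remove from `q` all value assignments to variables of `X`. -/
def stripX (X : Finset V) (q : PAssign V) : PAssign V := fun v => if v ∈ X then none else q v

/-- The clause `C|_q` is virtually redundant in `∃X.(F|_q)`: for every point `p`
such that the only clause of `F|_q` falsified by `p` is `C|_q` and `p` is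
`X`-removable in `F|_q`, there is an assignment `r` with `q* ⊆ r ⊊ q` such that
`p` is not `X`-removable in `F|_r`.  (If the set of such points `p` is empty
this holds vacuously, which is exactly regular redundancy.) -/
def VirtRed (X : Finset V) (F : Cnf V) (q : PAssign V) (C : Clause V) : Prop :=
  ∀ p : V → Bool,
    Clause.falsAt p (Clause.restrict q C) →
    (∀ D ∈ Cnf.restrict q F, Clause.falsAt p D → D = Clause.restrict q C) →
    Removable (Cnf.restrict q F) X p →
    ∃ r : PAssign V, PAssign.le (stripX X q) r ∧ PAssign.lt r q ∧
      ¬ Removable (Cnf.restrict r F) X p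

/-- The D-sequent `(∃X.F, q, H) → C` holds: for every member formula `W` with
`H ∪ {C} ⊆ W ⊆ F` such that `∃X.(W|_q) ≡ ∃X.(F|_q)`, the clause `C|_q` is
(at least virtually) redundant in `∃X.(W|_q)`. -/
def IsDseq (X : Finset V) (F : Cnf V) (q : PAssign V) (H : Cnf V) (C : Clause V) : Prop :=
  ∀ W : Cnf V, H ∪ {C} ⊆ W → W ⊆ F →
    Eqv X (Cnf.restrict q W) (Cnf.restrict q F) → VirtRed X W q C

/-- Consistency of the set of D-sequents `(q^i, H_i) → C_i`, `i = 1,…,k`: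
the conditionals are pairwise compatible and there is a total order `π` on the
clauses of `⋃ᵢ (H_i ∪ {C_i})` satisfying the order constraints. -/
def Consistent {k : ℕ} (qs : Fin k → PAssign V) (Hs : Fin k → Cnf V)
    (Cs : Fin k → Clause V) : Prop :=
  (∀ i j, PAssign.compatible (qs i) (qs j)) ∧
  ∃ π : Clause V → ℕ,
    Set.InjOn π (⋃ i, ((Hs i ∪ {Cs i} : Cnf V) : Set (Clause V))) ∧
    ∀ i, ∀ D ∈ Hs i, π (Cs i) < π D

/-- Clauses `C` and `D` are resolvable on `v`: they have opposite literals of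
exactly one variable, namely `v`. -/
def ClResolvable (C D : Clause V) (v : V) : Prop :=
  (∃ b : Bool, (⟨v, b⟩ : Lit V) ∈ C ∧ (⟨v, !b⟩ : Lit V) ∈ D) ∧
  ∀ u, u ≠ v → ∀ b : Bool, (⟨u, b⟩ : Lit V) ∈ C → (⟨u, !b⟩ : Lit V) ∉ D

/-- The clause `C` is blocked at variable `v` in the CNF formula `G`. -/
def Blocked (G : Cnf V) (C : Clause V) (v : V) : Prop := ∀ D ∈ G, ¬ ClResolvable C D v

/-- Assignments `q` and `r` are resolvable on `v`: exactly one commonly assigned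
variable, namely `v`, is assigned different values. -/
def PResolvable (q r : PAssign V) (v : V) : Prop :=
  (∃ b : Bool, q v = some b ∧ r v = some (!b)) ∧
  ∀ u, u ≠ v → ∀ b b' : Bool, q u = some b → r u = some b' → b = b'

/-- The resolvent of assignments `q` and `r` on `v`: all value assignments of
`q` and `r` except those to `v`. -/
def PResolvent (q r : PAssign V) (v : V) : PAssign V :=
  fun u => if u = v then none else (q u).orElse fun _ => r u

/-- If `p` is a `Z`-boundary point of `F` with `q ⊆ p` and `Z ⊆ X`, and
`p` is removable in `∃X.F`, then `p` is removable in `∃X.(F|_q)`. -/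
theorem removable_in_cofactor
    (X : Finset V) (F : Cnf V) (q : PAssign V)
    (hq : PAssign.dom q ⊆ ↑(Cnf.vars F))
    (Z : Finset V) (hZX : Z ⊆ X) (p : V → Bool)
    (hbnd : BoundaryPnt F Z p) (hqp : ExtendsPnt p q)
    (hrem : Removable F X p) :
    Removable (Cnf.restrict q F) X p := by
  obtain ⟨C, hC, hX, hf⟩ := hrem
  refine ⟨Clause.restrict q C, ?_, ?_, ?_⟩
  · intro t ht
    have hsat : Cnf.satAt (fun v => (q v).getD (t v)) F := by
      intro D hD
      by_cases hs : Clause.satBy q D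
      · obtain ⟨l, hl, hql⟩ := hs
        exact ⟨l, hl, by simp [hql]⟩
      · have hm : Clause.restrict q D ∈ Cnf.restrict q F :=
          Finset.mem_image_of_mem _ (Finset.mem_filter.2 ⟨hD, hs⟩)
        obtain ⟨l, hl, htl⟩ := ht _ hm
        obtain ⟨hlD, hne⟩ := Finset.mem_filter.1 hl
        refine ⟨l, hlD, ?_⟩
        cases hql : q l.var with
        | none => simpa [hql] using htl
        | some b =>
          rw [hql] at hne
          cases b <;> cases hp : l.pos <;> simp_all
    obtain ⟨l, hl, htl⟩ := hC _ hsat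
    have hpl := hf l hl
    cases hql : q l.var with
    | none =>
      refine ⟨l, Finset.mem_filter.2 ⟨hl, by simp [hql]⟩, ?_⟩
      simpa [hql] using htl
    | some b =>
      have hb := hqp _ _ hql
      simp only [hql, Option.getD_some] at htl
      rw [hb, htl] at hpl
      cases hp : l.pos <;> simp [hp] at hpl
  · apply Finset.subset_empty.1
    rw [← hX]
    exact Finset.inter_subset_inter_right
      (Finset.image_subset_image (Finset.filter_subset _ _))
  · intro l hl
    exact hf l (Finset.mem_filter.1 hl).1

end

end QE
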